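/- arXiv:2508.11642 — 5 statements merged into one kernel-verified Lean document; each statement's English description precedes it below -/
import Mathlib

section
/- Let R be a commutative ring and A a 4×4 matrix over R with entries a_{i j} (row i, column j, indices 1–4). Then det A = (a_{11}a_{22}a_{33}a_{44} + a_{13}a_{24}a_{31}a_{42} + a_{13}a_{22}a_{34}a_{41} + a_{14}a_{21}a_{33}a_{42} + a_{14}a_{22}a_{31}a_{43} + a_{11}a_{23}a_{34}a_{42} + a_{14}a_{23}a_{32}a_{41} + a_{12}a_{21}a_{34}a_{43} + a_{11}a_{24}a_{32}a_{43} + a_{12}a_{23}a_{31}a_{44} + a_{13}a_{21}a_{32}a_{44} + a_{12}a_{24}a_{33}a_{41}) − (a_{12}a_{23}a_{34}a_{41} + a_{14}a_{21}a_{32}a_{43} + a_{12}a_{24}a_{31}a_{43} + a_{11}a_{23}a_{32}a_{44} + a_{12}a_{21}a_{33}a_{44} + a_{13}a_{24}a_{32}a_{41} + a_{11}a_{24}a_{33}a_{42} + a_{13}a_{22}a_{31}a_{44} + a_{13}a_{21}a_{34}a_{42} + a_{14}a_{22}a_{33}a_{41} + a_{14}a_{23}a_{31}a_{42} + a_{11}a_{22}a_{34}a_{43}).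 -/
/-- Sarrus-type formula for the determinant of a `4 × 4` matrix over a commutative
ring: the determinant is the sum of the twelve "positive" diagonal products minus
the sum of the twelve "negative" diagonal products of the `4 × 19` arrangement.
Here `A i j` is the entry in row `i+1`, column `j+1` (so `A 0 0 = a₁₁`, etc.). -/
theorem det_fin_four_sarrus {R : Type*} [CommRing R] (A : Matrix (Fin 4) (Fin 4) R) :
    A.det =
      (A 0 0 * A 1 1 * A 2 2 * A 3 3 + A 0 2 * A 1 3 * A 2 0 * A 3 1 +
        A 0 2 * A 1 1 * A 2 3 * A 3 0 + A 0 3 * A 1 0 * A 2 2 * A 3 1 +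
        A 0 3 * A 1 1 * A 2 0 * A 3 2 + A 0 0 * A 1 2 * A 2 3 * A 3 1 +
        A 0 3 * A 1 2 * A 2 1 * A 3 0 + A 0 1 * A 1 0 * A 2 3 * A 3 2 +
        A 0 0 * A 1 3 * A 2 1 * A 3 2 + A 0 1 * A 1 2 * A 2 0 * A 3 3 +
        A 0 2 * A 1 0 * A 2 1 * A 3 3 + A 0 1 * A 1 3 * A 2 2 * A 3 0) -
      (A 0 1 * A 1 2 * A 2 3 * A 3 0 + A 0 3 * A 1 0 * A 2 1 * A 3 2 +
        A 0 1 * A 1 3 * A 2 0 * A 3 2 + A 0 0 * A 1 2 * A 2 1 * A 3 3 +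
        A 0 1 * A 1 0 * A 2 2 * A 3 3 + A 0 2 * A 1 3 * A 2 1 * A 3 0 +
        A 0 0 * A 1 3 * A 2 2 * A 3 1 + A 0 2 * A 1 1 * A 2 0 * A 3 3 +
        A 0 2 * A 1 0 * A 2 3 * A 3 1 + A 0 3 * A 1 1 * A 2 2 * A 3 0 +
        A 0 3 * A 1 2 * A 2 0 * A 3 1 + A 0 0 * A 1 1 * A 2 3 * A 3 2) := by
  rw [Matrix.det_succ_row_zero]
  simp only [Fin.sum_univ_four, Matrix.det_fin_three, Matrix.submatrix_apply]
  simp [Fin.succAbove, Fin.lt_def]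
  ring
end

section
/- Let R be a commutative ring and M a 5×5 matrix over R with entries M(i,j) (row i, column j, indices 1–5). With σ₁ = [1,2,3,4,5], σ₂ = [4,3,5,2,1], σ₃ = [2,5,1,3,4], σ₄ = [3,1,4,5,2], σ₅ = [5,4,2,1,3], σ₆ = [1,4,2,3,5], the sum Σ_{i=1}^{6} Σ_{h ∈ H} ∏_{j=1}^{5} M(j, σ_i(h(j))) equals Σ_{π ∈ A₅} ∏_{j=1}^{5} M(j, π(j)), the sum of the products indexed by all sixty even permutations of {1,2,3,4,5}. -/
open Equiv Equiv.Perm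

/-- The six column-order permutations `σ₁ = [1,2,3,4,5]`, `σ₂ = [4,3,5,2,1]`,
`σ₃ = [2,5,1,3,4]`, `σ₄ = [3,1,4,5,2]`, `σ₅ = [5,4,2,1,3]`, `σ₆ = [1,4,2,3,5]`
(where `[v₁,…,v₅]` sends `j` to `v_j`, written `0`-indexed via `Fin 5`). -/
def sarrusSigma : Fin 6 → Equiv.Perm (Fin 5) :=
  ![⟨![0, 1, 2, 3, 4], ![0, 1, 2, 3, 4], by decide, by decide⟩,
    ⟨![3, 2, 4, 1, 0], ![4, 3, 1, 0, 2], by decide, by decide⟩,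
    ⟨![1, 4, 0, 2, 3], ![2, 0, 3, 4, 1], by decide, by decide⟩,
    ⟨![2, 0, 3, 4, 1], ![1, 4, 0, 2, 3], by decide, by decide⟩,
    ⟨![4, 3, 1, 0, 2], ![3, 2, 4, 1, 0], by decide, by decide⟩,
    ⟨![0, 3, 1, 2, 4], ![0, 2, 3, 1, 4], by decide, by decide⟩]

/-- The dihedral subgroup of order ten generated by `finRotate 5`, as a finset. -/
def dihedralFinset : Finset (Equiv.Perm (Fin 5)) :=
  {1, finRotate 5, finRotate 5 ^ 2, finRotate 5 ^ 3, finRotate 5 ^ 4,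
    swap 0 4 * swap 1 3, swap 1 4 * swap 2 3, swap 0 1 * swap 2 4,
    swap 0 2 * swap 3 4, swap 0 3 * swap 1 2}

theorem card_dihedralFinset : dihedralFinset.card = 10 := by decide

set_option maxRecDepth 100000 in
theorem sign_eq_one_of_mem_dihedralFinset : ∀ h ∈ dihedralFinset, sign h = 1 := by decide

theorem sign_sarrusSigma : ∀ i, sign (sarrusSigma i) = 1 := by decide

set_option maxRecDepth 100000 in
theorem mul_inv_mem_dihedralFinset :
    ∀ g ∈ dihedralFinset, ∀ h ∈ dihedralFinset, g * h⁻¹ ∈ dihedralFinset := by decide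

theorem eq_of_inv_mul_sarrusSigma_mem :
    ∀ i j, (sarrusSigma i)⁻¹ * sarrusSigma j ∈ dihedralFinset → i = j := by decide

/-- The cosets `σᵢ H` are pairwise disjoint. -/
theorem injOn_sarrusSigma_mul :
    Set.InjOn (fun p : Fin 6 × Equiv.Perm (Fin 5) => sarrusSigma p.1 * p.2)
      (Finset.univ ×ˢ dihedralFinset : Finset (Fin 6 × Equiv.Perm (Fin 5))) := by
  rintro ⟨i, g⟩ hg ⟨j, h⟩ hh (e : sarrusSigma i * g = sarrusSigma j * h)
  simp only [Finset.coe_product, Set.mem_prod, Finset.mem_coe, Finset.mem_univ, true_and] at hg hh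
  have key : (sarrusSigma i)⁻¹ * sarrusSigma j = g * h⁻¹ := by
    rw [inv_mul_eq_iff_eq_mul, ← mul_assoc, e, mul_inv_cancel_right]
  obtain rfl := eq_of_inv_mul_sarrusSigma_mem i j (key ▸ mul_inv_mem_dihedralFinset g hg h hh)
  rw [mul_left_cancel e]

theorem card_filter_sign_eq_one :
    (Finset.univ.filter (fun π : Equiv.Perm (Fin 5) => sign π = 1)).card = 60 := by
  rw [← Fintype.card_subtype, ← Nat.card_eq_fintype_card]
  exact nat_card_alternatingGroup.trans (by simp [Nat.factorial])

/-- The cosets `σᵢ H` cover the even permutations. -/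
theorem image_sarrusSigma_mul :
    (Finset.univ ×ˢ dihedralFinset).image
        (fun p : Fin 6 × Equiv.Perm (Fin 5) => sarrusSigma p.1 * p.2) =
      Finset.univ.filter (fun π : Equiv.Perm (Fin 5) => sign π = 1) := by
  apply Finset.eq_of_subset_of_card_le
  · intro π hπ
    obtain ⟨⟨i, h⟩, hp, rfl⟩ := Finset.mem_image.mp hπ
    simp [sign_sarrusSigma, sign_eq_one_of_mem_dihedralFinset h (Finset.mem_product.mp hp).2]
  · rw [Finset.card_image_of_injOn injOn_sarrusSigma_mul, Finset.card_product,
      card_dihedralFinset, card_filter_sign_eq_one]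
    simp

/-- For a `5 × 5` matrix `M` over a commutative ring, the double sum
`Σ_{i=1}^{6} Σ_{h ∈ H} ∏_j M (j, σᵢ (h j))` — where `H` is the order-`10`
dihedral subgroup `{id, c, c², c³, c⁴, (1 5)(2 4), (2 5)(3 4), (1 2)(3 5),
(1 3)(4 5), (1 4)(2 3)}` with `c = (1 2 3 4 5)` — equals the sum over all sixty
even permutations `π` of the products `∏_j M (j, π j)`. -/
theorem sum_sigma_cosets_eq_sum_even_perms {R : Type*} [CommRing R]
    (M : Matrix (Fin 5) (Fin 5) R) :
    (∑ i : Fin 6,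
        ∑ h ∈ ({1, finRotate 5, finRotate 5 ^ 2, finRotate 5 ^ 3, finRotate 5 ^ 4,
            swap 0 4 * swap 1 3, swap 1 4 * swap 2 3, swap 0 1 * swap 2 4,
            swap 0 2 * swap 3 4, swap 0 3 * swap 1 2} : Finset (Equiv.Perm (Fin 5))),
          ∏ j : Fin 5, M j (sarrusSigma i (h j))) =
      ∑ π ∈ Finset.univ.filter (fun π : Equiv.Perm (Fin 5) => Equiv.Perm.sign π = 1),
        ∏ j : Fin 5, M j (π j) := by
  rw [← image_sarrusSigma_mul, Finset.sum_image injOn_sarrusSigma_mul, Finset.sum_product]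
  rfl
end

section
/- Let R be a commutative ring and M a 5×5 matrix over R with entries M(i,j) (row i, column j, indices 1–5). Define the cyclic Sarrus sum of a 5×5 matrix N by D(N) = Σ_{p=1}^{5} ∏_{i=1}^{5} N(i, ((p+i−2) mod 5)+1) + Σ_{p=1}^{5} ∏_{i=1}^{5} N(i, ((p+4−i) mod 5)+1). Let σ₁ = [1,2,3,4,5], σ₂ = [4,3,5,2,1], σ₃ = [2,5,1,3,4], σ₄ = [3,1,4,5,2], σ₅ = [5,4,2,1,3], σ₆ = [1,4,2,3,5] and τ₁ = [1,2,4,3,5], τ₂ = [3,4,5,2,1], τ₃ = [2,5,1,4,3], τ₄ = [4,1,3,5,2], τ₅ = [5,3,2,1,4], τ₆ = [1,3,2,4,5]. Then det M = Σ_{i=1}^{6} D(Mσ_i) − Σ_{i=1}^{6} D(Mτ_i), where Mσ denotes the matrix with columns reordered by σ, i.e., Mσ(i,j) = M(i, σ(j)). -/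
open Equiv Equiv.Perm

/-- The cyclic Sarrus sum of a `5 × 5` matrix: the sum of the five descending and
the five ascending diagonal products of the `5 × 9` array whose `k`-th column is
column `((k-1) mod 5) + 1` of `N` (written with mod-`5` arithmetic on `Fin 5`). -/
def cyclicSarrusSum {R : Type*} [CommRing R] (N : Matrix (Fin 5) (Fin 5) R) : R :=
  (∑ p : Fin 5, ∏ i : Fin 5, N i (p + i)) + ∑ p : Fin 5, ∏ i : Fin 5, N i (p + 4 - i)

/-- The six column-order permutations `τ₁ = [1,2,4,3,5]`, `τ₂ = [3,4,5,2,1]`,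
`τ₃ = [2,5,1,4,3]`, `τ₄ = [4,1,3,5,2]`, `τ₅ = [5,3,2,1,4]`, `τ₆ = [1,3,2,4,5]`
(where `[v₁,…,v₅]` sends `j` to `v_j`, written `0`-indexed via `Fin 5`). -/
def sarrusTau : Fin 6 → Equiv.Perm (Fin 5) :=
  ![⟨![0, 1, 3, 2, 4], ![0, 1, 3, 2, 4], by decide, by decide⟩,
    ⟨![2, 3, 4, 1, 0], ![4, 3, 0, 1, 2], by decide, by decide⟩,
    ⟨![1, 4, 0, 3, 2], ![2, 0, 4, 3, 1], by decide, by decide⟩,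
    ⟨![3, 0, 2, 4, 1], ![1, 4, 2, 0, 3], by decide, by decide⟩,
    ⟨![4, 2, 1, 0, 3], ![3, 2, 1, 4, 0], by decide, by decide⟩,
    ⟨![0, 2, 1, 3, 4], ![0, 2, 1, 3, 4], by decide, by decide⟩]

/-- Sarrus-type formula for the `5 × 5` determinant: `det M` equals the sum of
the cyclic Sarrus sums of the six column reorderings of `M` by `σ₁, …, σ₆` minus
the sum of the cyclic Sarrus sums of the six column reorderings by `τ₁, …, τ₆`. -/
theorem det_fin_five_sarrus {R : Type*} [CommRing R] (M : Matrix (Fin 5) (Fin 5) R) :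
    M.det =
      (∑ i : Fin 6, cyclicSarrusSum (Matrix.of fun r j => M r (sarrusSigma i j))) -
        ∑ i : Fin 6, cyclicSarrusSum (Matrix.of fun r j => M r (sarrusTau i j)) := by
  simp [Matrix.det_succ_row_zero, Fin.sum_univ_succ, Fin.prod_univ_succ, cyclicSarrusSum,
    sarrusSigma, sarrusTau, Fin.succAbove]
  ring
end

section
/- Let d = (1 2 3 4) be the 4-cycle in the symmetric group S₄ and let K = {id, d, d², d³, (1 4)(2 3), (2 4), (1 2)(3 4), (1 3)}. Then K is a subgroup of S₄ of order 8 equal to the subgroup generated by d and (1 3), each ρ_i in the list ρ₁ = [1,2,3,4], ρ₂ = [3,2,4,1], ρ₃ = [4,2,1,3] (where [v₁,…,v₄] denotes the permutation sending j to v_j) is an even permutation, the three left cosets ρ₁K, ρ₂K, ρ₃K are pairwise disjoint, and their union is all of S₄. -/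
open Equiv Equiv.Perm

/-- The three column-order permutations `ρ₁ = [1,2,3,4]`, `ρ₂ = [3,2,4,1]`,
`ρ₃ = [4,2,1,3]` of the three `7`-column blocks of the Sarrus-type `4 × 19`
arrangement (where `[v₁,…,v₄]` sends `j` to `v_j`, written `0`-indexed
via `Fin 4`). -/
def sarrusRho : Fin 3 → Equiv.Perm (Fin 4) :=
  ![⟨![0, 1, 2, 3], ![0, 1, 2, 3], by decide, by decide⟩,
    ⟨![2, 1, 3, 0], ![3, 1, 0, 2], by decide, by decide⟩,
    ⟨![3, 1, 0, 2], ![2, 1, 3, 0], by decide, by decide⟩]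

/-- The dihedral group of symmetries of a square with vertices `0, 1, 2, 3` in cyclic order,
listed as a finset of permutations. -/
def squareSymmetries : Finset (Equiv.Perm (Fin 4)) :=
  {1, finRotate 4, finRotate 4 ^ 2, finRotate 4 ^ 3, swap 0 3 * swap 1 2, swap 1 3,
    swap 0 1 * swap 2 3, swap 0 2}

theorem card_squareSymmetries : squareSymmetries.card = 8 := by
  decide +kernel

/-- The dihedral group of symmetries of a square, as a subgroup of `S₄`. -/
def squareSymmetryGroup : Subgroup (Equiv.Perm (Fin 4)) where
  carrier := squareSymmetries
  one_mem' := by simp [squareSymmetries]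
  mul_mem' := by
    have h : ∀ a ∈ squareSymmetries, ∀ b ∈ squareSymmetries, a * b ∈ squareSymmetries := by
      decide +kernel
    exact fun {a b} ha hb => h a ha b hb
  inv_mem' := by
    have h : ∀ a ∈ squareSymmetries, a⁻¹ ∈ squareSymmetries := by decide +kernel
    exact fun {a} ha => h a ha

theorem closure_finRotate_swap :
    Subgroup.closure {finRotate 4, swap 0 2} = squareSymmetryGroup := by
  apply le_antisymm
  · rw [Subgroup.closure_le]
    rintro x (rfl | rfl)
    · change finRotate 4 ∈ squareSymmetries
      simp [squareSymmetries]
    · change swap 0 2 ∈ squareSymmetries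
      simp [squareSymmetries]
  · have hd : finRotate 4 ∈ Subgroup.closure {finRotate 4, swap (0 : Fin 4) 2} :=
      Subgroup.subset_closure (by simp)
    have hs : swap (0 : Fin 4) 2 ∈ Subgroup.closure {finRotate 4, swap (0 : Fin 4) 2} :=
      Subgroup.subset_closure (by simp)
    have h : ∀ a ∈ squareSymmetries, ∃ m : Fin 4, ∃ n : Fin 2,
        a = finRotate 4 ^ (m : ℕ) * swap 0 2 ^ (n : ℕ) := by decide +kernel
    intro x hx
    obtain ⟨m, n, rfl⟩ := h x hx
    exact mul_mem (pow_mem hd _) (pow_mem hs _)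

theorem sign_sarrusRho (i : Fin 3) : Equiv.Perm.sign (sarrusRho i) = 1 := by
  revert i
  decide +kernel

theorem sarrusRho_mul_ne {i j : Fin 3} (hij : i ≠ j) {a b : Equiv.Perm (Fin 4)}
    (ha : a ∈ squareSymmetries) (hb : b ∈ squareSymmetries) :
    sarrusRho i * a ≠ sarrusRho j * b := by
  have h : ∀ i j : Fin 3, i ≠ j → ∀ a ∈ squareSymmetries, ∀ b ∈ squareSymmetries,
      sarrusRho i * a ≠ sarrusRho j * b := by decide +kernel
  exact h i j hij a ha b hb

theorem exists_sarrusRho_mul_eq (x : Equiv.Perm (Fin 4)) :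
    ∃ i : Fin 3, ∃ a ∈ squareSymmetries, sarrusRho i * a = x := by
  revert x
  decide +kernel

/-- With `d = (1 2 3 4)` the `4`-cycle in `S₄`, the set
`K = {id, d, d², d³, (1 4)(2 3), (2 4), (1 2)(3 4), (1 3)}` is a subgroup of `S₄`
of order `8` equal to the subgroup generated by `d` and `(1 3)`; each `ρᵢ` is an
even permutation; and the three left cosets `ρ₁K, ρ₂K, ρ₃K` are pairwise
disjoint with union all of `S₄`.  (Written `0`-indexed via `Fin 4`, so
`d = finRotate 4` and e.g. `(1 3)` is `swap 0 2`.) -/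
theorem dihedral_subgroup_of_S4_and_coset_reps :
    let d : Equiv.Perm (Fin 4) := finRotate 4
    let K : Set (Equiv.Perm (Fin 4)) :=
      {1, d, d ^ 2, d ^ 3, swap 0 3 * swap 1 2, swap 1 3, swap 0 1 * swap 2 3, swap 0 2}
    (∃ G : Subgroup (Equiv.Perm (Fin 4)), (G : Set (Equiv.Perm (Fin 4))) = K) ∧
      Nat.card K = 8 ∧
      ((Subgroup.closure {d, swap 0 2} : Subgroup (Equiv.Perm (Fin 4))) :
          Set (Equiv.Perm (Fin 4))) = K ∧
      (∀ i : Fin 3, Equiv.Perm.sign (sarrusRho i) = 1) ∧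
      (∀ i j : Fin 3, i ≠ j →
        Disjoint ((fun h => sarrusRho i * h) '' K) ((fun h => sarrusRho j * h) '' K)) ∧
      (⋃ i : Fin 3, (fun h => sarrusRho i * h) '' K) = Set.univ := by
  intro d K
  have hK : K = squareSymmetries := by simp [K, d, squareSymmetries]
  rw [hK]
  refine ⟨⟨squareSymmetryGroup, rfl⟩, ?_, ?_, sign_sarrusRho, ?_, ?_⟩
  · simp [card_squareSymmetries]
  · rw [closure_finRotate_swap]
    rfl
  · intro i j hij
    rw [Set.disjoint_left]
    rintro _ ⟨a, ha, rfl⟩ ⟨b, hb, hab⟩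
    exact sarrusRho_mul_ne hij ha hb hab.symm
  · refine Set.eq_univ_of_forall fun x => ?_
    obtain ⟨i, a, ha, rfl⟩ := exists_sarrusRho_mul_eq x
    exact Set.mem_iUnion.2 ⟨i, a, ha, rfl⟩
end

section
/- Let R be a commutative ring, A a 4×4 matrix over R with entries a_{i j} (row i, column j, indices 1–4), and ρ an even permutation of {1,2,3,4}. Consider the 4×7 array whose k-th column is column ρ(((k−1) mod 4)+1) of A, and form its signed diagonal sum: the descending and ascending diagonal products starting at positions 1 and 3 are taken with sign +, those starting at positions 2 and 4 with sign −. This signed diagonal sum equals Σ_{h ∈ K} sgn(h) ∏_{i=1}^{4} a_{i, ρ(h(i))}, where K = {id, d, d², d³, (1 4)(2 3), (2 4), (1 2)(3 4), (1 3)} is the order-8 dihedral subgroup of S₄ generated by the 4-cycle d = (1 2 3 4) and (1 3), and sgn(h) denotes the sign of h. -/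
open Equiv Equiv.Perm

/-- For an even permutation `ρ` of the columns of a `4 × 4` matrix `A`, the signed
diagonal sum of the `4 × 7` array whose `k`-th column is column
`ρ(((k-1) mod 4)+1)` of `A` — descending and ascending diagonals starting at
positions `1` and `3` taken with sign `+`, those starting at positions `2` and `4`
with sign `−` — equals `Σ_{h ∈ K} sgn(h) • ∏ i, a_{i, ρ(h(i))}`, where `K` is the
order-`8` dihedral subgroup `{id, d, d², d³, (1 4)(2 3), (2 4), (1 2)(3 4), (1 3)}`
of `S₄` generated by `d = (1 2 3 4)` and `(1 3)`.  (Written `0`-indexed via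
`Fin 4`: the descending diagonal starting at `0`-indexed position `p` is
`∏ i, A i (ρ (p + i))` and the ascending one is `∏ i, A i (ρ (p + 3 - i))`,
with all index arithmetic mod `4`.) -/
theorem sarrus_block_signed_sum_eq_coset_sum {R : Type*} [CommRing R]
    (A : Matrix (Fin 4) (Fin 4) R) (ρ : Equiv.Perm (Fin 4))
    (hρ : Equiv.Perm.sign ρ = 1) :
    ((∏ i : Fin 4, A i (ρ (0 + i))) + (∏ i : Fin 4, A i (ρ (2 + i))) +
        (∏ i : Fin 4, A i (ρ (0 + 3 - i))) + (∏ i : Fin 4, A i (ρ (2 + 3 - i)))) -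
      ((∏ i : Fin 4, A i (ρ (1 + i))) + (∏ i : Fin 4, A i (ρ (3 + i))) +
        (∏ i : Fin 4, A i (ρ (1 + 3 - i))) + (∏ i : Fin 4, A i (ρ (3 + 3 - i)))) =
    ∑ h ∈ ({1, finRotate 4, finRotate 4 ^ 2, finRotate 4 ^ 3,
        swap 0 3 * swap 1 2, swap 1 3, swap 0 1 * swap 2 3, swap 0 2} :
          Finset (Equiv.Perm (Fin 4))),
      Equiv.Perm.sign h • ∏ i : Fin 4, A i (ρ (h i)) := by
  have signs : sign (finRotate 4) = -1 ∧ sign (finRotate 4 ^ 2) = 1 ∧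
      sign (finRotate 4 ^ 3) = -1 ∧ sign (swap 0 3 * swap 1 2 : Equiv.Perm (Fin 4)) = 1 ∧
      sign (swap 1 3 : Equiv.Perm (Fin 4)) = -1 ∧
      sign (swap 0 1 * swap 2 3 : Equiv.Perm (Fin 4)) = 1 ∧
      sign (swap 0 2 : Equiv.Perm (Fin 4)) = -1 := by decide
  obtain ⟨s₁, s₂, s₃, s₄, s₅, s₆, s₇⟩ := signs
  have r₁ : ∀ i : Fin 4, finRotate 4 i = 1 + i := by decide
  have r₂ : ∀ i : Fin 4, (finRotate 4 ^ 2) i = 2 + i := by decide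
  have r₃ : ∀ i : Fin 4, (finRotate 4 ^ 3) i = 3 + i := by decide
  have r₄ : ∀ i : Fin 4, (swap 0 3 * swap 1 2 : Equiv.Perm (Fin 4)) i = 0 + 3 - i := by decide
  have r₅ : ∀ i : Fin 4, (swap 1 3 : Equiv.Perm (Fin 4)) i = 1 + 3 - i := by decide
  have r₆ : ∀ i : Fin 4, (swap 0 1 * swap 2 3 : Equiv.Perm (Fin 4)) i = 2 + 3 - i := by decide
  have r₇ : ∀ i : Fin 4, (swap 0 2 : Equiv.Perm (Fin 4)) i = 3 + 3 - i := by decide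
  repeat rw [Finset.sum_insert (by decide)]
  rw [Finset.sum_singleton]
  simp only [r₁, r₂, r₃, r₄, r₅, r₆, r₇, s₁, s₂, s₃, s₄, s₅, s₆, s₇, Perm.sign_one, Perm.one_apply,
    one_smul, zero_add, Units.neg_smul]
  ring
end
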